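/- arXiv:1310.7207 — 2 statements merged into one kernel-verified Lean document; each statement's English description precedes it below -/
import Mathlib

section
/- Let f, g ∈ GF(q)[X,Y] be two-variable polynomials, d = deg f, and suppose the coefficient of X^d in f is nonzero. For y ∈ GF(q) let h_y = deg gcd(f(X,y), g(X,y)) as polynomials in GF(q)[X]. Then for every y₀ ∈ GF(q): Σ_{y ∈ GF(q)} max(h_y - h_{y₀}, 0) ≤ (deg f - h_{y₀})(deg g - h_{y₀}). -/
open Polynomial

/-- Substituting `Y := y` in a bivariate polynomial `f(X,Y)` (variable `0` is `X`,
variable `1` is `Y`), yielding a univariate polynomial in `X`. -/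
noncomputable def substY {F : Type*} [Field F] (f : MvPolynomial (Fin 2) F) (y : F) :
    Polynomial F :=
  MvPolynomial.aeval ![Polynomial.X, Polynomial.C y] f

namespace Matrix

variable {ι : Type*} [Fintype ι] [DecidableEq ι]

/-- If `d j` divides every entry of the `j`-th column, then `∏ d j` divides the determinant. -/
theorem prod_dvd_det_of_dvd_col {R : Type*} [CommRing R] (M : Matrix ι ι R) (d : ι → R)
    (hd : ∀ i j, d j ∣ M i j) : ∏ j, d j ∣ M.det := by
  rw [det_apply']
  exact Finset.dvd_sum fun σ _ =>
    Dvd.dvd.mul_left (Finset.prod_dvd_prod_of_dvd _ _ fun j _ => hd (σ j) j) _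

/-- Weighted-homogeneous bound for the degree of a determinant of polynomials. -/
theorem natDegree_det_add_sum_le {R : Type*} [CommRing R] (M : Matrix ι ι R[X]) (r c : ι → ℕ)
    (hM : ∀ i j, M i j ≠ 0 → (M i j).natDegree + r i ≤ c j) (hdet : M.det ≠ 0) :
    M.det.natDegree + ∑ i, r i ≤ ∑ j, c j := by
  have key : ∀ σ : Equiv.Perm ι, ∏ i, M (σ i) i ≠ 0 →
      (∏ i, M (σ i) i).natDegree + ∑ i, r i ≤ ∑ j, c j := by
    intro σ hσ
    have hne : ∀ i, M (σ i) i ≠ 0 := fun i hi => hσ (Finset.prod_eq_zero (Finset.mem_univ i) hi)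
    calc _ ≤ ∑ i, (M (σ i) i).natDegree + ∑ i, r (σ i) := by
          rw [Equiv.sum_comp σ r]
          exact Nat.add_le_add_right (natDegree_prod_le _ _) _
      _ ≤ _ := by
          rw [← Finset.sum_add_distrib]
          exact Finset.sum_le_sum fun i _ => hM _ _ (hne i)
  obtain ⟨σ, hσ⟩ : ∃ σ : Equiv.Perm ι, ∏ i, M (σ i) i ≠ 0 := by
    by_contra! h
    exact hdet (by simp [det_apply', h])
  have hle := key σ hσ
  have : M.det.natDegree ≤ ∑ j, c j - ∑ i, r i := by
    rw [det_apply]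
    refine natDegree_sum_le_of_forall_le _ _ fun τ _ => ?_
    refine (natDegree_smul_le _ _).trans ?_
    by_cases hτ : ∏ i, M (τ i) i = 0
    · simp [hτ]
    · have := key τ hτ
      omega
  omega

/-- If a polynomial matrix evaluated at `y` has `e` independent kernel vectors, then its
determinant vanishes at `y` to order at least `e`. -/
theorem X_sub_C_pow_dvd_det {K : Type*} [Field K] (M : Matrix ι ι K[X]) (y : K) {e : ℕ}
    (v : Fin e → ι → K) (hv : LinearIndependent K v)
    (hker : ∀ t, M.map (eval y) *ᵥ v t = 0) : (X - C y) ^ e ∣ M.det := by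
  classical
  let b₀ := Module.Basis.sumExtend hv
  let eqv := b₀.indexEquiv (Pi.basisFun K ι)
  let b := b₀.reindex eqv
  have hb : ∀ t, b (eqv (Sum.inl t)) = v t := fun t => by
    simp only [b, b₀, Module.Basis.sumExtend, Module.Basis.reindex_apply, Equiv.symm_apply_apply,
      Module.Basis.extend_apply_self]
    rfl
  let P : Matrix ι ι K := (Pi.basisFun K ι).toMatrix b
  have hP : IsUnit (P.map C).det := by
    have : IsUnit P.det := by
      have := (Pi.basisFun K ι).invertibleToMatrix b
      exact isUnit_det_of_invertible P
    have h := this.map (C : K →+* K[X])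
    rwa [RingHom.map_det] at h
  have hPt : ∀ i j, P i j = b j i := fun i j => by simp [P, Module.Basis.toMatrix_apply]
  let S : Finset ι := Finset.univ.image fun t => eqv (Sum.inl t)
  have hS : S.card = e := by
    exact (Finset.card_image_of_injective _ (eqv.injective.comp Sum.inl_injective)).trans (by simp)
  have hdvd := prod_dvd_det_of_dvd_col (M * P.map C) (fun j => if j ∈ S then X - C y else 1) ?_
  · rw [det_mul, hP.dvd_mul_right, Finset.prod_ite_mem, Finset.univ_inter,
      Finset.prod_const, hS] at hdvd
    exact hdvd
  · intro i j
    by_cases hj : j ∈ S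
    · obtain ⟨t, -, rfl⟩ := Finset.mem_image.1 hj
      rw [if_pos hj, dvd_iff_isRoot, IsRoot.def]
      refine Eq.trans ?_ (congrFun (hker t) i)
      simp [mul_apply, eval_finsetSum, hPt, hb, mulVec, dotProduct]
    · simp [hj]

end Matrix

namespace Polynomial

/-- The square matrix of the linear map `(a, b) ↦ a * f + b * g`, with `deg a < A` and `deg b < B`,
read off in the coefficients of `X ^ k, …, X ^ (k + A + B - 1)`. Its determinant is, up to sign,
a subresultant of `f` and `g`. -/
noncomputable def subresultantMatrix {R : Type*} [CommRing R] (f g : R[X]) (k A B : ℕ) :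
    Matrix (Fin A ⊕ Fin B) (Fin A ⊕ Fin B) R :=
  Matrix.of fun j i => (Sum.elim (fun i : Fin A => X ^ (i : ℕ) * f)
    (fun i : Fin B => X ^ (i : ℕ) * g) i).coeff (k + finSumFinEquiv j)

theorem subresultantMatrix_map {R S : Type*} [CommRing R] [CommRing S] (φ : R →+* S) (f g : R[X])
    (k A B : ℕ) :
    (subresultantMatrix f g k A B).map φ = subresultantMatrix (f.map φ) (g.map φ) k A B := by
  ext j (i | i) <;> simp [subresultantMatrix, coeff_X_pow_mul', apply_ite φ]

open Classical in
theorem ofFn_mul_coeff {R : Type*} [CommRing R] {n : ℕ} (v : Fin n → R) (p : R[X]) (m : ℕ) :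
    (ofFn n v * p).coeff m = ∑ i, (X ^ (i : ℕ) * p).coeff m * v i := by
  rw [ofFn_eq_sum_monomial, Finset.sum_mul, finsetSum_coeff]
  refine Finset.sum_congr rfl fun i _ => ?_
  rw [← C_mul_X_pow_eq_monomial, mul_assoc, coeff_C_mul, mul_comm]

open Classical in
theorem subresultantMatrix_mulVec {R : Type*} [CommRing R] (f g : R[X]) (k A B : ℕ)
    (v : Fin A ⊕ Fin B → R) (j : Fin A ⊕ Fin B) :
    (subresultantMatrix f g k A B).mulVec v j =
      (ofFn A (v ∘ Sum.inl) * f + ofFn B (v ∘ Sum.inr) * g).coeff (k + finSumFinEquiv j) := by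
  simp [Matrix.mulVec, dotProduct, subresultantMatrix, ofFn_mul_coeff]

variable {K : Type*} [Field K] {f g f₁ g₁ G x y : K[X]} {k A B : ℕ}

theorem prod_X_sub_C_pow_dvd [Fintype K] {R : K[X]} {e : K → ℕ}
    (h : ∀ y, (X - C y) ^ e y ∣ R) : ∏ y, (X - C y) ^ e y ∣ R :=
  Finset.prod_dvd_of_coprime
    (fun _ _ _ _ hab => (pairwise_coprime_X_sub_C Function.injective_id hab).pow) fun y _ => h y

theorem isCoprime_of_eq_mul_add_mul (hG0 : G ≠ 0) (hf : f = G * f₁) (hg : g = G * g₁)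
    (hG : G = f * x + g * y) : IsCoprime f₁ g₁ := by
  refine ⟨x, y, mul_left_cancel₀ hG0 ?_⟩
  subst hf hg
  linear_combination -hG

theorem det_subresultantMatrix_ne_zero (hf0 : f ≠ 0) (hf : f = G * f₁) (hg : g = G * g₁)
    (hG : G = f * x + g * y) (hk : G.natDegree = k) (hfdeg : f.natDegree = k + B)
    (hgdeg : g.natDegree ≤ k + A) : (subresultantMatrix f g k A B).det ≠ 0 := by
  classical
  have hG0 : G ≠ 0 := by rintro rfl; simp [hf] at hf0
  have hf₁0 : f₁ ≠ 0 := by rintro rfl; simp [hf] at hf0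
  have hf₁deg : f₁.natDegree = B := by
    rw [hf, natDegree_mul hG0 hf₁0] at hfdeg
    omega
  have hcop := isCoprime_of_eq_mul_add_mul hG0 hf hg hG
  intro hdet
  obtain ⟨v, hv0, hv⟩ := Matrix.exists_mulVec_eq_zero_iff.2 hdet
  set p := ofFn A (v ∘ Sum.inl) with hp
  set q := ofFn B (v ∘ Sum.inr) with hq
  have hpdeg : p.degree < A := ofFn_degree_lt _
  have hqdeg : q.degree < B := ofFn_degree_lt _
  have hpf : (p * f).degree < (k + A + B : ℕ) := by
    by_cases h : p = 0
    · simp [h]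
    · rw [← natDegree_lt_iff_degree_lt (mul_ne_zero h hf0), natDegree_mul h hf0]
      rw [← natDegree_lt_iff_degree_lt h] at hpdeg
      omega
  have hqg : (q * g).degree < (k + A + B : ℕ) := by
    by_cases h : q * g = 0
    · simp [h]
    · rw [← natDegree_lt_iff_degree_lt h, natDegree_mul (left_ne_zero_of_mul h)
        (right_ne_zero_of_mul h)]
      rw [← natDegree_lt_iff_degree_lt (left_ne_zero_of_mul h)] at hqdeg
      omega
  have hsum : p * f + q * g = 0 := by
    refine eq_zero_of_dvd_of_degree_lt (p := G) ⟨p * f₁ + q * g₁, by rw [hf, hg]; ring⟩ ?_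
    rw [degree_eq_natDegree hG0, hk, degree_lt_iff_coeff_zero]
    intro m hm
    by_cases hm' : m < k + A + B
    · have := congrFun hv (finSumFinEquiv.symm ⟨m - k, by omega⟩)
      rw [subresultantMatrix_mulVec] at this
      simpa [Nat.add_sub_cancel' hm] using this
    · refine coeff_eq_zero_of_degree_lt ((degree_add_le _ _).trans_lt ((max_lt hpf hqg).trans_le ?_))
      exact_mod_cast not_lt.1 hm'
  have hsum₁ : p * f₁ + q * g₁ = 0 := by
    refine mul_left_cancel₀ hG0 ?_
    rw [mul_zero, ← hsum, hf, hg]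
    ring
  have hq0 : q = 0 := by
    refine eq_zero_of_dvd_of_degree_lt (hcop.dvd_of_dvd_mul_right ?_) ?_
    · exact (⟨-p, by linear_combination hsum₁⟩ : f₁ ∣ q * g₁)
    · rwa [degree_eq_natDegree hf₁0, hf₁deg]
  have hp0 : p = 0 := by
    rw [hq0, zero_mul, add_zero] at hsum₁
    exact (mul_eq_zero.1 hsum₁).resolve_right hf₁0
  have hl := injective_ofFn A (hp0.trans (map_zero _).symm)
  have hr := injective_ofFn B (hq0.trans (map_zero _).symm)
  apply hv0
  ext (i | i)
  · exact congrFun hl i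
  · exact congrFun hr i

theorem exists_linearIndependent_ker_subresultantMatrix {e : ℕ} (hf0 : f ≠ 0) (hf : f = G * f₁)
    (hg : g = G * g₁) (hk : G.natDegree = k + e) (hfdeg : f.natDegree = k + B)
    (hgdeg : g.natDegree ≤ k + A) :
    ∃ v : Fin e → Fin A ⊕ Fin B → K, LinearIndependent K v ∧
      ∀ t, (subresultantMatrix f g k A B).mulVec (v t) = 0 := by
  classical
  have hG0 : G ≠ 0 := by rintro rfl; simp [hf] at hf0
  have hf₁0 : f₁ ≠ 0 := by rintro rfl; simp [hf] at hf0
  have hf₁deg : e + f₁.natDegree = B := by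
    rw [hf, natDegree_mul hG0 hf₁0] at hfdeg
    omega
  refine ⟨fun t => Sum.elim (toFn A (-(X ^ (t : ℕ) * g₁))) (toFn B (X ^ (t : ℕ) * f₁)), ?_, ?_⟩
  · rw [Fintype.linearIndependent_iff]
    intro c hc t
    have hsum : ofFn e c * f₁ = ∑ t, c t • (X ^ (t : ℕ) * f₁) := by
      rw [ofFn_eq_sum_monomial, Finset.sum_mul]
      refine Finset.sum_congr rfl fun i _ => ?_
      rw [← C_mul_X_pow_eq_monomial, mul_assoc, smul_eq_C_mul]
    have hto : toFn B (ofFn e c * f₁) = 0 := by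
      rw [hsum, map_sum]
      ext i
      simpa using congrFun hc (Sum.inr i)
    have hlt : (ofFn e c * f₁).natDegree < B := by
      have := ofFn_natDegree_lt (n := e) (by have := t.2; omega) c
      have := natDegree_mul_le (p := ofFn e c) (q := f₁)
      omega
    have h0 : ofFn e c * f₁ = 0 := by
      rw [← ofFn_comp_toFn_eq_id_of_natDegree_lt hlt, hto, map_zero]
    have := injective_ofFn e
      (((mul_eq_zero.1 h0).resolve_right hf₁0).trans (map_zero (ofFn e)).symm)
    exact congrFun this t
  · intro t
    ext j
    have hB : (X ^ (t : ℕ) * f₁).natDegree < B := by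
      rw [natDegree_X_pow_mul _ hf₁0]
      have := t.2
      omega
    have hA : ofFn A (toFn A (-(X ^ (t : ℕ) * g₁))) = -(X ^ (t : ℕ) * g₁) := by
      by_cases hg₁0 : g₁ = 0
      · simp [hg₁0]
      · refine ofFn_comp_toFn_eq_id_of_natDegree_lt ?_
        rw [natDegree_neg, natDegree_X_pow_mul _ hg₁0]
        rw [hg, natDegree_mul hG0 hg₁0] at hgdeg
        have := t.2
        omega
    rw [subresultantMatrix_mulVec, Sum.elim_comp_inl, Sum.elim_comp_inr, hA,
      ofFn_comp_toFn_eq_id_of_natDegree_lt hB, hf, hg]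
    have : -(X ^ (t : ℕ) * g₁) * (G * f₁) + X ^ (t : ℕ) * f₁ * (G * g₁) = 0 := by ring
    rw [this]
    simp

/-- The subresultant of two polynomials over `K[Y]` whose coefficients are bounded in degree as
those of bivariate polynomials of total degree `k + B` and `k + A` has degree at most `A * B`. -/
theorem natDegree_det_subresultantMatrix_le {R : Type*} [CommRing R] {f g : R[X][X]}
    (hf : ∀ j, f.coeff j ≠ 0 → (f.coeff j).natDegree + j ≤ k + B)
    (hg : ∀ j, g.coeff j ≠ 0 → (g.coeff j).natDegree + j ≤ k + A)
    (hdet : (subresultantMatrix f g k A B).det ≠ 0) :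
    (subresultantMatrix f g k A B).det.natDegree ≤ A * B := by
  have := Matrix.natDegree_det_add_sum_le _ (fun j => k + finSumFinEquiv j)
    (Sum.elim (fun i : Fin A => k + B + i) (fun i : Fin B => k + A + i)) ?_ hdet
  · simp only [Fintype.sum_sum_type, finSumFinEquiv_apply_left, finSumFinEquiv_apply_right,
      Sum.elim_inl, Sum.elim_inr, Fin.val_castAdd, Fin.val_natAdd, Finset.sum_add_distrib,
      Finset.sum_const, Finset.card_univ, Fintype.card_sum, Fintype.card_fin, smul_eq_mul] at this
    nlinarith
  · rintro j (i | i) hne <;>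
      simp only [subresultantMatrix, Matrix.of_apply, Sum.elim_inl, Sum.elim_inr,
        coeff_X_pow_mul'] at hne ⊢ <;>
      split_ifs at hne ⊢ with hi
    · have := hf _ hne
      omega
    · exact absurd rfl hne
    · have := hg _ hne
      omega
    · exact absurd rfl hne

end Polynomial

namespace MvPolynomial

variable {F : Type*} [Field F]

/-- A polynomial in `X` and `Y` viewed as a polynomial in `X` over `F[Y]`. -/
noncomputable def toBivariate (f : MvPolynomial (Fin 2) F) : F[X][X] :=
  aeval ![Polynomial.X, Polynomial.C Polynomial.X] f

theorem toBivariate_monomial (s : Fin 2 →₀ ℕ) (c : F) :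
    toBivariate (monomial s c) = Polynomial.monomial (s 0) (Polynomial.monomial (s 1) c) := by
  rw [toBivariate, aeval_monomial, Finsupp.prod_fintype _ _ (by simp), Fin.prod_univ_two,
    ← Polynomial.C_mul_X_pow_eq_monomial, ← Polynomial.C_mul_X_pow_eq_monomial, map_mul, map_pow]
  simp only [Matrix.cons_val_zero, Matrix.cons_val_one, Polynomial.algebraMap_apply,
    Algebra.algebraMap_self_apply]
  ring

theorem coeff_coeff_toBivariate (f : MvPolynomial (Fin 2) F) (i j : ℕ) :
    ((toBivariate f).coeff j).coeff i = f.coeff (Finsupp.single 0 j + Finsupp.single 1 i) := by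
  induction f using MvPolynomial.induction_on' with
  | monomial s c =>
    have hs : s = Finsupp.single 0 j + Finsupp.single 1 i ↔ s 0 = j ∧ s 1 = i := by
      simp [Finsupp.ext_iff, Fin.forall_fin_two]
    rw [toBivariate_monomial, coeff_monomial, Polynomial.coeff_monomial]
    simp only [hs]
    by_cases h0 : s 0 = j <;> simp [h0, Polynomial.coeff_monomial]
  | add p q hp hq =>
    rw [toBivariate] at hp hq ⊢
    rw [map_add, Polynomial.coeff_add, Polynomial.coeff_add, hp, hq, coeff_add]

theorem natDegree_coeff_toBivariate_add_le (f : MvPolynomial (Fin 2) F) {j : ℕ}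
    (hj : (toBivariate f).coeff j ≠ 0) :
    ((toBivariate f).coeff j).natDegree + j ≤ f.totalDegree := by
  have h := Polynomial.leadingCoeff_ne_zero.2 hj
  rw [Polynomial.leadingCoeff, coeff_coeff_toBivariate] at h
  have := le_totalDegree (mem_support_iff.2 h)
  rw [Finsupp.sum_fintype _ _ (by simp), Fin.sum_univ_two] at this
  simp at this
  omega

end MvPolynomial

section substY

open MvPolynomial

variable {F : Type*} [Field F]

theorem substY_eq_map_toBivariate (f : MvPolynomial (Fin 2) F) (y : F) :
    substY f y = (toBivariate f).map (evalRingHom y) := by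
  induction f using MvPolynomial.induction_on' with
  | monomial s c =>
    rw [toBivariate_monomial, substY, MvPolynomial.aeval_monomial,
      Finsupp.prod_fintype _ _ (by simp), Fin.prod_univ_two, Polynomial.map_monomial,
      ← Polynomial.C_mul_X_pow_eq_monomial]
    simp
    ring
  | add p q hp hq =>
    simp only [substY, toBivariate, map_add, Polynomial.map_add] at *
    rw [hp, hq]

theorem natDegree_substY_le (f : MvPolynomial (Fin 2) F) (y : F) :
    (substY f y).natDegree ≤ f.totalDegree := by
  rw [natDegree_le_iff_coeff_eq_zero]
  intro j hj
  have : (toBivariate f).coeff j = 0 := by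
    by_contra h
    have := natDegree_coeff_toBivariate_add_le f h
    omega
  simp [substY_eq_map_toBivariate, this]

theorem coeff_totalDegree_substY (f : MvPolynomial (Fin 2) F) (y : F) :
    (substY f y).coeff f.totalDegree = f.coeff (Finsupp.single 0 f.totalDegree) := by
  have hdeg : ((toBivariate f).coeff f.totalDegree).natDegree = 0 := by
    by_cases h : (toBivariate f).coeff f.totalDegree = 0
    · simp [h]
    · have := natDegree_coeff_toBivariate_add_le f h
      omega
  rw [substY_eq_map_toBivariate, Polynomial.coeff_map, eq_C_of_natDegree_eq_zero hdeg,
    coeff_coeff_toBivariate]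
  simp

end substY

theorem szonyi_weiner_lemma
    {F : Type*} [Field F] [Fintype F] [DecidableEq F]
    (f g : MvPolynomial (Fin 2) F) (d : ℕ) (hd : d = f.totalDegree)
    -- the coefficient of `X^d` in `f` is nonzero
    (hlead : MvPolynomial.coeff (Finsupp.single 0 d) f ≠ 0)
    (h : F → ℕ)
    (hh : ∀ y : F, h y = (EuclideanDomain.gcd (substY f y) (substY g y)).natDegree)
    (y₀ : F) :
    ∑ y : F, max ((h y : ℤ) - h y₀) 0 ≤
      ((f.totalDegree : ℤ) - h y₀) * ((g.totalDegree : ℤ) - h y₀) := by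
  classical
  subst hd
  set k := h y₀ with hk
  have hfdeg : ∀ y, (substY f y).natDegree = f.totalDegree := fun y =>
    le_antisymm (natDegree_substY_le f y)
      (le_natDegree_of_ne_zero (by rwa [coeff_totalDegree_substY]))
  have hf0 : ∀ y, substY f y ≠ 0 := fun y hy =>
    hlead (by rw [← coeff_totalDegree_substY f y, hy, Polynomial.coeff_zero])
  have hle : ∀ y, h y ≤ f.totalDegree := fun y => by
    rw [hh, ← hfdeg y]
    exact natDegree_le_of_dvd (EuclideanDomain.gcd_dvd_left _ _) (hf0 y)
  have hmax : ∀ y, max ((h y : ℤ) - k) 0 = ((h y - k : ℕ) : ℤ) := fun y => by omega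
  simp only [hmax]
  rw [← Nat.cast_sum]
  by_cases hkg : k ≤ g.totalDegree
  · obtain ⟨A, hA⟩ := Nat.exists_eq_add_of_le hkg
    obtain ⟨B, hB⟩ := Nat.exists_eq_add_of_le (hle y₀)
    rw [← hk] at hB
    let M := subresultantMatrix (MvPolynomial.toBivariate f) (MvPolynomial.toBivariate g) k A B
    have hM : ∀ y, M.map (eval y) = subresultantMatrix (substY f y) (substY g y) k A B :=
      fun y => by
        rw [substY_eq_map_toBivariate, substY_eq_map_toBivariate, ← subresultantMatrix_map]
        rfl
    have hgdeg : ∀ y, (substY g y).natDegree ≤ k + A := fun y => hA ▸ natDegree_substY_le g y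
    have hfdeg' : ∀ y, (substY f y).natDegree = k + B := fun y => hB ▸ hfdeg y
    have hdet : M.det ≠ 0 := by
      obtain ⟨f₁, hf₁⟩ := EuclideanDomain.gcd_dvd_left (substY f y₀) (substY g y₀)
      obtain ⟨g₁, hg₁⟩ := EuclideanDomain.gcd_dvd_right (substY f y₀) (substY g y₀)
      have hne := det_subresultantMatrix_ne_zero (hf0 y₀) hf₁ hg₁
        (EuclideanDomain.gcd_eq_gcd_ab _ _) (hh y₀).symm (hfdeg' y₀) (hgdeg y₀)
      intro h0
      refine hne ?_
      rw [← hM]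
      exact ((evalRingHom y₀).map_det M).symm.trans (by rw [h0, map_zero])
    have hdvd : ∀ y, (X - C y) ^ (h y - k) ∣ M.det := by
      intro y
      by_cases hky : k ≤ h y
      · obtain ⟨f₁, hf₁⟩ := EuclideanDomain.gcd_dvd_left (substY f y) (substY g y)
        obtain ⟨g₁, hg₁⟩ := EuclideanDomain.gcd_dvd_right (substY f y) (substY g y)
        obtain ⟨v, hv, hker⟩ := exists_linearIndependent_ker_subresultantMatrix (k := k)
          (e := h y - k) (hf0 y) hf₁ hg₁ (by rw [← hh]; omega) (hfdeg' y) (hgdeg y)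
        exact M.X_sub_C_pow_dvd_det y v hv fun t => by rw [hM, hker]
      · simp [Nat.sub_eq_zero_of_le (not_le.1 hky).le]
    have hsum : ∑ y, (h y - k) ≤ M.det.natDegree := by
      refine le_trans (le_of_eq ?_) (natDegree_le_of_dvd (prod_X_sub_C_pow_dvd hdvd) hdet)
      rw [natDegree_prod_of_monic _ _ fun y _ => (monic_X_sub_C y).pow _]
      simp
    have hbound : M.det.natDegree ≤ A * B :=
      natDegree_det_subresultantMatrix_le
        (fun j hj => hB ▸ MvPolynomial.natDegree_coeff_toBivariate_add_le f hj)
        (fun j hj => hA ▸ MvPolynomial.natDegree_coeff_toBivariate_add_le g hj) hdet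
    rw [hA, hB]
    push_cast
    rw [add_sub_cancel_left, add_sub_cancel_left, mul_comm]
    exact_mod_cast hsum.trans hbound
  · have hg0 : substY g y₀ = 0 := by
      by_contra hne
      refine hkg ((hk.trans (hh y₀)).le.trans (le_trans ?_ (natDegree_substY_le g y₀)))
      exact natDegree_le_of_dvd (EuclideanDomain.gcd_dvd_right _ _) hne
    have hkf : k = f.totalDegree := by
      rw [hk, hh, hg0, EuclideanDomain.gcd_zero_right, hfdeg]
    have h0 : ∀ y, h y - k = 0 := fun y => by
      have := hle y
      omega
    rw [Finset.sum_eq_zero fun y _ => h0 y, hkf]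
    simp
end

section
/- Let S be a semioval (1-semiarc) in PG(2,q) with a (q-1)-secant ℓ and |S| < 5q/2 - 7/2. Suppose additionally that the q-1 tangent lines to S at the points of S ∩ ℓ all pass through a common point C ∉ ℓ. Then S is contained in the vertexless triangle determined by C and the two points A, B of ℓ \ S (i.e., S ⊆ (AB ∪ AC ∪ BC) \ {A, B, C}), and one of the lines AC, BC is also a (q-1)-secant of S. -/
open Configuration Projectivization
open scoped LinearAlgebra.Projectivization

/-- The points of `PG(2,F)`. Via the `Configuration.ofField` instance, the same type
also serves as the type of lines, with `p ∈ l` meaning that the point `p` lies on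
the line `l` (vanishing of the dot product of homogeneous coordinates). -/
abbrev PG (F : Type*) [Field F] := ℙ F (Fin 3 → F)

/-- A `t`-semiarc in `PG(2,F)`: a nonempty pointset such that through each of its
points there pass exactly `t` tangent lines. -/
def IsSemiarcPG {F : Type*} [Field F] (t : ℕ) (S : Set (PG F)) : Prop :=
  S.Nonempty ∧ ∀ p ∈ S, Nat.card {l : PG F | {x : PG F | x ∈ l} ∩ S = {p}} = t

lemma vec_ne_zero {F : Type*} [Field F] (v : Fin 3 → F) (i : Fin 3) (h : v i ≠ 0) :
    v ≠ 0 := fun hv => h (by simp [hv])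

lemma ofField_eq_or_eq {F : Type*} [Field F] [DecidableEq F] {p₁ p₂ l₁ l₂ : PG F}
    (h₁ : p₁ ∈ l₁) (h₂ : p₂ ∈ l₁) (h₃ : p₁ ∈ l₂) (h₄ : p₂ ∈ l₂) : p₁ = p₂ ∨ l₁ = l₂ :=
  Nondegenerate.eq_or_eq h₁ h₂ h₃ h₄

lemma ofField_exists_line {F : Type*} [Field F] [DecidableEq F] {p₁ p₂ : PG F} (h : p₁ ≠ p₂) :
    ∃ l : PG F, p₁ ∈ l ∧ p₂ ∈ l :=
  ⟨HasLines.mkLine h, HasLines.mkLine_ax h⟩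

lemma ofField_exists_point {F : Type*} [Field F] [DecidableEq F] {l₁ l₂ : PG F} (h : l₁ ≠ l₂) :
    ∃ p : PG F, p ∈ l₁ ∧ p ∈ l₂ :=
  ⟨HasPoints.mkPoint h, HasPoints.mkPoint_ax h⟩

lemma ncard_points_eq_ncard_points {F : Type*} [Field F] [Fintype F] [DecidableEq F]
    (l m : PG F) : {x : PG F | x ∈ l}.ncard = {x : PG F | x ∈ m}.ncard :=
  ProjectivePlane.pointCount_eq_pointCount (PG F) l m

/-- If all tangents at the points of `S` on `ℓ` pass through `C`, and some point `Q` of the side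
`m` of the triangle is missing from `S`, then the opposite side `n` is full. -/
lemma full_side_of_missing_point {F : Type*} [Field F] [DecidableEq F] {S : Set (PG F)}
    {ℓ m n A B C Q R : PG F} (hAB : A ≠ B) (hABl : {x : PG F | x ∈ ℓ} \ S = {A, B}) (hCl : C ∉ ℓ)
    (htan : ∀ p ∈ {x : PG F | x ∈ ℓ} ∩ S,
      ∀ l : PG F, {x : PG F | x ∈ l} ∩ S = {p} → C ∈ l)
    (hAm : A ∈ m) (hCm : C ∈ m) (hBn : B ∈ n) (hCn : C ∈ n)
    (hsub : ∀ x ∈ S, x ∈ ℓ ∨ x ∈ m ∨ x ∈ n)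
    (hQ : Q ∈ m) (hQA : Q ≠ A) (hQC : Q ≠ C) (hQS : Q ∉ S)
    (hR : R ∈ n) (hRB : R ≠ B) (hRC : R ≠ C) : R ∈ S := by
  have hA : A ∈ ℓ := (hABl.symm ▸ Set.mem_insert A {B} : A ∈ {x : PG F | x ∈ ℓ} \ S).1
  have hB : B ∈ ℓ := (hABl.symm ▸ Set.mem_insert_of_mem A rfl : B ∈ {x : PG F | x ∈ ℓ} \ S).1
  have hmn : m ≠ n := by
    rintro rfl
    rcases ofField_eq_or_eq hA hB hAm hBn with h | rfl
    exacts [hAB h, hCl hCm]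
  have hQℓ : Q ∉ ℓ := fun h => by
    rcases ofField_eq_or_eq h hA hQ hAm with h | rfl
    exacts [hQA h, hCl hCm]
  have hRℓ : R ∉ ℓ := fun h => by
    rcases ofField_eq_or_eq h hB hR hBn with h | rfl
    exacts [hRB h, hCl hCn]
  have hRm : R ∉ m := fun h => (ofField_eq_or_eq h hCm hR hCn).elim hRC hmn
  have hQn : Q ∉ n := fun h => (ofField_eq_or_eq hQ hCm h hCn).elim hQC hmn
  obtain ⟨k, hQk, hRk⟩ := ofField_exists_line (fun h => hRm (h ▸ hQ) : Q ≠ R)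
  have hkm : k ≠ m := fun h => hRm (h ▸ hRk)
  have hkn : k ≠ n := fun h => hQn (h ▸ hQk)
  have hkℓ : k ≠ ℓ := fun h => hQℓ (h ▸ hQk)
  obtain ⟨P, hPk, hPℓ⟩ := ofField_exists_point hkℓ
  have hPS : P ∈ S := by
    by_contra hP
    have hP' : P ∈ ({A, B} : Set (PG F)) := hABl ▸ ⟨hPℓ, hP⟩
    rcases hP' with rfl | rfl
    · exact (ofField_eq_or_eq hQk hPk hQ hAm).elim hQA hkm
    · exact (ofField_eq_or_eq hRk hPk hR hBn).elim hRB hkn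
  have hCk : C ∉ k := fun h => (ofField_eq_or_eq hQk h hQ hCm).elim hQC hkm
  by_contra hRS
  refine hCk (htan P ⟨hPℓ, hPS⟩ k (Set.Subset.antisymm ?_ ?_))
  · rintro x ⟨hxk, hxS⟩
    rcases hsub x hxS with h | h | h
    · exact (ofField_eq_or_eq hxk hPk h hPℓ).resolve_right hkℓ
    · have := (ofField_eq_or_eq hxk hQk h hQ).resolve_right hkm
      exact absurd (this ▸ hxS) hQS
    · have := (ofField_eq_or_eq hxk hRk h hR).resolve_right hkn
      exact absurd (this ▸ hxS) hRS
  · rintro x rfl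
    exact ⟨hPk, hPS⟩

theorem semioval_q_sub_one_secant_vertexless_triangle
    {F : Type*} [Field F] [Fintype F] [DecidableEq F]
    (q : ℕ) (hq : Fintype.card F = q)
    (S : Set (PG F)) (hS : IsSemiarcPG 1 S)
    (ℓ : PG F) (hsec : ({x : PG F | x ∈ ℓ} ∩ S).ncard = q - 1)
    (hsize : (2 : ℚ) * S.ncard < 5 * q - 7)
    (A B : PG F) (hAB : A ≠ B) (hABl : {x : PG F | x ∈ ℓ} \ S = {A, B})
    (C : PG F) (hCl : C ∉ ℓ)
    -- the tangents at the points of `S ∩ ℓ` all pass through `C`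
    (htan : ∀ p ∈ {x : PG F | x ∈ ℓ} ∩ S,
      ∀ l : PG F, {x : PG F | x ∈ l} ∩ S = {p} → C ∈ l) :
    ∀ lA lB : PG F, A ∈ lA → C ∈ lA → B ∈ lB → C ∈ lB →
      (S ⊆ ({x : PG F | x ∈ ℓ} ∪ {x : PG F | x ∈ lA} ∪ {x : PG F | x ∈ lB}) \
          ({A, B, C} : Set (PG F)) ∧
        (({x : PG F | x ∈ lA} ∩ S).ncard = q - 1 ∨
          ({x : PG F | x ∈ lB} ∩ S).ncard = q - 1)) := by
  intro lA lB hAlA hClA hBlB hClB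
  have hA : A ∈ {x : PG F | x ∈ ℓ} \ S := hABl.symm ▸ Set.mem_insert A {B}
  have hB : B ∈ {x : PG F | x ∈ ℓ} \ S := hABl.symm ▸ Set.mem_insert_of_mem A rfl
  have htan_through : ∀ P ∈ ℓ, P ∈ S → ∀ k : PG F, P ∈ k → C ∈ k →
      {x : PG F | x ∈ k} ∩ S = {P} := by
    intro P hPℓ hPS k hPk hCk
    obtain ⟨⟨⟨t, ht⟩⟩, -⟩ := Nat.card_pos_iff.mp (by rw [hS.2 P hPS]; exact one_pos)
    have ht' : {x : PG F | x ∈ t} ∩ S = {P} := ht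
    have hPt : P ∈ {x : PG F | x ∈ t} ∩ S := ht' ▸ rfl
    rcases ofField_eq_or_eq hPt.1 (htan P ⟨hPℓ, hPS⟩ t ht') hPk hCk with h | rfl
    exacts [absurd hPℓ (h ▸ hCl), ht']
  have hCS : C ∉ S := by
    intro hCS
    have hq1 : 1 < Fintype.card F := Fintype.one_lt_card
    obtain ⟨P, hPℓ, hPS⟩ := Set.nonempty_of_ncard_ne_zero
      (by omega : ({x : PG F | x ∈ ℓ} ∩ S).ncard ≠ 0)
    have hPC : P ≠ C := fun h => hCl (h ▸ hPℓ)
    obtain ⟨k, hPk, hCk⟩ := ofField_exists_line hPC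
    have hC : C ∈ ({P} : Set (PG F)) := htan_through P hPℓ hPS k hPk hCk ▸ ⟨hCk, hCS⟩
    exact hPC (Set.mem_singleton_iff.mp hC).symm
  have hsub : ∀ x ∈ S, x ∈ ℓ ∨ x ∈ lA ∨ x ∈ lB := by
    intro x hxS
    by_contra! ⟨hxℓ, hxA, hxB⟩
    obtain ⟨k, hxk, hCk⟩ := ofField_exists_line (fun h => hCS (h ▸ hxS) : x ≠ C)
    obtain ⟨P, hPk, hPℓ⟩ := ofField_exists_point (fun h => hxℓ (h ▸ hxk) : k ≠ ℓ)
    by_cases hPS : P ∈ S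
    · have hx : x ∈ ({P} : Set (PG F)) := htan_through P hPℓ hPS k hPk hCk ▸ ⟨hxk, hxS⟩
      exact hxℓ (Set.mem_singleton_iff.mp hx ▸ hPℓ)
    · have hP' : P ∈ ({A, B} : Set (PG F)) := hABl ▸ ⟨hPℓ, hPS⟩
      have hPC : P ≠ C := fun h => hCl (h ▸ hPℓ)
      rcases hP' with rfl | rfl
      · exact hxA ((ofField_eq_or_eq hPk hCk hAlA hClA).resolve_left hPC ▸ hxk)
      · exact hxB ((ofField_eq_or_eq hPk hCk hBlB hClB).resolve_left hPC ▸ hxk)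
  have hfull : ∀ D ∉ S, D ∈ ℓ → ∀ n : PG F, D ∈ n → C ∈ n →
      (∀ R ∈ n, R ≠ D → R ≠ C → R ∈ S) → ({x : PG F | x ∈ n} ∩ S).ncard = q - 1 := by
    intro D hDS hDℓ n hDn hCn hn
    have hdiff : {x : PG F | x ∈ n} \ S = {D, C} := by
      ext x
      constructor
      · rintro ⟨hxn, hxS⟩
        by_contra! hx
        simp only [Set.mem_insert_iff, Set.mem_singleton_iff, not_or] at hx
        exact hxS (hn x hxn hx.1 hx.2)
      · rintro (rfl | rfl)
        exacts [⟨hDn, hDS⟩, ⟨hCn, hCS⟩]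
    have h₁ := Set.ncard_inter_add_ncard_sdiff_eq_ncard {x : PG F | x ∈ n} S (Set.toFinite _)
    have h₂ := Set.ncard_inter_add_ncard_sdiff_eq_ncard {x : PG F | x ∈ ℓ} S (Set.toFinite _)
    rw [hdiff, Set.ncard_pair (fun h => hCl (h ▸ hDℓ) : D ≠ C)] at h₁
    rw [hABl, Set.ncard_pair hAB, hsec] at h₂
    have := ncard_points_eq_ncard_points n ℓ
    omega
  refine ⟨fun x hxS => ⟨?_, ?_⟩, ?_⟩
  · rcases hsub x hxS with h | h | h
    exacts [Or.inl (Or.inl h), Or.inl (Or.inr h), Or.inr h]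
  · rintro (rfl | rfl | rfl)
    exacts [hA.2 hxS, hB.2 hxS, hCS hxS]
  · by_cases hX : ∀ Q ∈ lA, Q ≠ A → Q ≠ C → Q ∈ S
    · exact Or.inl (hfull A hA.2 hA.1 lA hAlA hClA hX)
    · push Not at hX
      obtain ⟨Q, hQ, hQA, hQC, hQS⟩ := hX
      exact Or.inr (hfull B hB.2 hB.1 lB hBlB hClB fun R hR hRB hRC =>
        full_side_of_missing_point hAB hABl hCl htan hAlA hClA hBlB hClB hsub hQ hQA hQC hQS
          hR hRB hRC)
end
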